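/- (Proposition 2) For every real γ < 2 there exist an open shop instance with delivery times on 2 machines and a feasible schedule σ* of it such that every non-delay feasible schedule σ of that instance satisfies Lmax(σ) > γ · Lmax(σ*). In particular, no list scheduling algorithm can have a performance ratio less than 2 for the problem O2||Lmax. -/

import Mathlib

/-- A feasible (non-preemptive) open shop schedule. -/
def OpenShopFeasible (m n : ℕ) (p s : Fin m → Fin n → ℝ) : Prop :=
  (∀ i j, 0 ≤ s i j) ∧
  (∀ i : Fin m, ∀ j j' : Fin n, j ≠ j' → 0 < p i j → 0 < p i j' →
    Disjoint (Set.Ico (s i j) (s i j + p i j)) (Set.Ico (s i j') (s i j' + p i j'))) ∧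
  (∀ j : Fin n, ∀ i i' : Fin m, i ≠ i' → 0 < p i j → 0 < p i' j →
    Disjoint (Set.Ico (s i j) (s i j + p i j)) (Set.Ico (s i' j) (s i' j + p i' j)))

/-- A non-delay (list) schedule: no machine is idle while an operation is available. -/
def OpenShopNonDelay (m n : ℕ) (p s : Fin m → Fin n → ℝ) : Prop :=
  ¬ ∃ (i : Fin m) (j : Fin n) (t : ℝ), 0 < p i j ∧ 0 ≤ t ∧ t < s i j ∧
      (∀ j' : Fin n, 0 < p i j' → t ∉ Set.Ico (s i j') (s i j' + p i j')) ∧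
      (∀ i' : Fin m, 0 < p i' j → t ∉ Set.Ico (s i' j) (s i' j + p i' j))

/-- The maximum lateness of a schedule. -/
noncomputable def OpenShopLmax (m n : ℕ) (p s : Fin m → Fin n → ℝ) (q : Fin n → ℝ) : ℝ :=
  ⨆ j : Fin n, ((⨆ i : Fin m, (s i j + p i j)) + q j)

theorem OpenShopNonDelay.exists_start_eq_zero {m n : ℕ} {p s : Fin m → Fin n → ℝ}
    (hs : ∀ i j, 0 ≤ s i j) (hnd : OpenShopNonDelay m n p s) {i : Fin m} {j : Fin n}
    (hp : 0 < p i j) (hother : ∀ i', 0 < p i' j → i' = i) :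
    ∃ j', 0 < p i j' ∧ s i j' = 0 := by
  by_contra! h
  refine hnd ⟨i, j, 0, hp, le_rfl, lt_of_le_of_ne (hs i j) (h j hp).symm, ?_, ?_⟩
  · rintro j' hj' ⟨h0, -⟩
    exact h j' hj' (le_antisymm h0 (hs i j'))
  · rintro i' hi' ⟨h0, -⟩
    obtain rfl := hother i' hi'
    exact h j hp (le_antisymm h0 (hs i' j))

theorem add_le_openShopLmax {m n : ℕ} (p s : Fin m → Fin n → ℝ) (q : Fin n → ℝ)
    (i : Fin m) (j : Fin n) : s i j + p i j + q j ≤ OpenShopLmax m n p s q :=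
  (add_le_add_left (le_ciSup (f := fun i => s i j + p i j) (Set.finite_range _).bddAbove i)
    (q j)).trans
    (le_ciSup (f := fun j => (⨆ i : Fin m, (s i j + p i j)) + q j)
      (Set.finite_range _).bddAbove j)

theorem openShopLmax_le {m n : ℕ} [NeZero m] [NeZero n] {p s : Fin m → Fin n → ℝ}
    {q : Fin n → ℝ} {c : ℝ} (h : ∀ i j, s i j + p i j + q j ≤ c) :
    OpenShopLmax m n p s q ≤ c :=
  ciSup_le fun j => le_sub_iff_add_le.mp (ciSup_le fun i => le_sub_iff_add_le.mpr (h i j))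

/-- Proposition 2: for every `γ < 2` there is a two-machine open shop instance with
delivery times and a feasible schedule `σ*` of it such that every non-delay feasible
schedule `σ` satisfies `Lmax(σ) > γ · Lmax(σ*)`; hence no list scheduling algorithm
has performance ratio less than 2 for `O2||Lmax`. -/
theorem no_list_ratio_below_two (γ : ℝ) (hγ : γ < 2) :
    ∃ (n : ℕ) (_ : 0 < n) (p : Fin 2 → Fin n → ℝ) (q : Fin n → ℝ),
      (∀ i j, 0 ≤ p i j) ∧ (∀ j, 0 ≤ q j) ∧
      ∃ sstar : Fin 2 → Fin n → ℝ, OpenShopFeasible 2 n p sstar ∧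
        ∀ s : Fin 2 → Fin n → ℝ,
          OpenShopFeasible 2 n p s → OpenShopNonDelay 2 n p s →
          γ * OpenShopLmax 2 n p sstar q < OpenShopLmax 2 n p s q := by
  obtain ⟨ε, hε, hγε⟩ : ∃ ε : ℝ, 0 < ε ∧ γ * (1 + 2 * ε) < 2 :=
    ⟨(2 - γ) / 4, by linarith, by nlinarith [mul_pos (sub_pos.2 hγ) (sub_pos.2 hγ)]⟩
  refine ⟨3, by norm_num, ![![ε, 1, 0], ![ε, 0, 1]], ![1, 0, 0], ?_, ?_,
    ![![0, 2 * ε, 0], ![ε, 0, 2 * ε]], ⟨?_, ?_, ?_⟩, ?_⟩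
  · intro i j
    fin_cases i <;> fin_cases j <;> simp [hε.le]
  · intro j
    fin_cases j <;> simp
  · intro i j
    fin_cases i <;> fin_cases j <;> simp [hε.le]
  · intro i j j' hne hj hj'
    rw [Set.Ico_disjoint_Ico]
    fin_cases i <;> fin_cases j <;> fin_cases j' <;> simp at hne hj hj' ⊢ <;> grind
  · intro j i i' hne hi hi'
    rw [Set.Ico_disjoint_Ico]
    fin_cases j <;> fin_cases i <;> fin_cases i' <;> simp at hne hi hi' ⊢
  intro s ⟨hs, hmachine, hjob⟩ hnd
  set p : Fin 2 → Fin 3 → ℝ := ![![ε, 1, 0], ![ε, 0, 1]] with hp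
  have hopt : OpenShopLmax 2 3 p ![![0, 2 * ε, 0], ![ε, 0, 2 * ε]] ![1, 0, 0] = 1 + 2 * ε := by
    apply le_antisymm
    · refine openShopLmax_le fun i j => ?_
      fin_cases i <;> fin_cases j <;> simp [hp] <;> linarith
    · refine le_trans ?_ (add_le_openShopLmax _ _ _ 1 0)
      simp [hp]
      linarith
  rw [hopt]
  refine hγε.trans_le ?_
  have hurgent : 1 ≤ s 0 0 ∨ 1 ≤ s 1 0 := by
    obtain ⟨j₀, hj₀, hs₀⟩ := hnd.exists_start_eq_zero hs (i := 0) (j := 1) (by simp [hp])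
      (fun i hi => by fin_cases i <;> simp [hp] at hi ⊢)
    obtain ⟨j₁, hj₁, hs₁⟩ := hnd.exists_start_eq_zero hs (i := 1) (j := 2) (by simp [hp])
      (fun i hi => by fin_cases i <;> simp [hp] at hi ⊢)
    have hzero₀ : s 0 0 = 0 ∨ s 0 1 = 0 := by
      fin_cases j₀ <;> simp [hp] at hj₀ hs₀ <;> simp [hs₀]
    have hzero₁ : s 1 0 = 0 ∨ s 1 2 = 0 := by
      fin_cases j₁ <;> simp [hp] at hj₁ hs₁ <;> simp [hs₁]
    have h₀ := Set.Ico_disjoint_Ico.mp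
      (hmachine 0 0 1 (by simp) (by simpa [hp]) (by simp [hp]))
    have h₁ := Set.Ico_disjoint_Ico.mp
      (hmachine 1 0 2 (by simp) (by simpa [hp]) (by simp [hp]))
    have h₂ := Set.Ico_disjoint_Ico.mp
      (hjob 0 0 1 (by simp) (by simpa [hp]) (by simpa [hp]))
    have hs₀₀ := hs 0 0
    have hs₁₀ := hs 1 0
    simp only [hp, Matrix.cons_val] at h₀ h₁ h₂
    clear_value p
    clear hopt hnd hmachine hjob hs
    grind
  rcases hurgent with h | h
  · refine le_trans ?_ (add_le_openShopLmax _ _ _ 0 0)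
    simp [hp]
    linarith
  · refine le_trans ?_ (add_le_openShopLmax _ _ _ 1 0)
    simp [hp]
    linarith
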